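/- arXiv:1509.05439 — 6 statements merged into one kernel-verified Lean document; each statement's English description precedes it below -/
import Mathlib

section
/- Let 1 ≤ k ≤ d be integers, let U ⊆ ℝ^k be open, let Ψ: U → ℝ^d be a C^∞ map, and let V ⊆ U be compact. Define Φ(s) = (1, Ψ(s)) ∈ ℝ^{d+1} and f(s_1, …, s_{d+1}) = det[Φ(s_1) ⋯ Φ(s_{d+1})]. Then there exists a constant C > 0 such that for all s_1, …, s_{d+1} ∈ V, |f(s_1, …, s_{d+1})| ≤ C · dist((s_1,…,s_{d+1}), Δ)^{N_{k,d}}, where Δ = {(t,…,t) : t ∈ U} ⊆ U^{d+1} is the diagonal and dist is the distance in (ℝ^k)^{d+1} with the max norm. -/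
open Set Filter Metric MeasureTheory
noncomputable section

/-- A point of `ℝ^d` is *rational* if all of its coordinates are rational numbers. -/
def IsRatPt {d : ℕ} (x : Fin d → ℝ) : Prop := ∀ i, ∃ a : ℚ, x i = (a : ℝ)

/-- The *height* of a rational point `x ∈ ℚ^d ⊆ ℝ^d`: the least positive integer `q`
with `q • x ∈ ℤ^d`. -/
def ht {d : ℕ} (x : Fin d → ℝ) : ℕ :=
  sInf {q : ℕ | 0 < q ∧ ∀ i, ∃ m : ℤ, (q : ℝ) * x i = (m : ℝ)}

/-- `Ssum k n = [k-1,1] + [k-1,2] + ⋯ + [k-1,n]` where `[n,m] = C(n+m,m)`. -/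
def Ssum (k n : ℕ) : ℕ := ∑ j ∈ Finset.Icc 1 n, Nat.choose (k - 1 + j) j

/-- `nkd k d` is the largest `n ≥ 0` with `[k-1,1] + ⋯ + [k-1,n] ≤ d`. -/
def nkd (k d : ℕ) : ℕ := sSup {n : ℕ | Ssum k n ≤ d}

/-- `mkd k d = d − ([k-1,1] + ⋯ + [k-1,n_{k,d}])`. -/
def mkd (k d : ℕ) : ℕ := d - Ssum k (nkd k d)

/-- `Nkd k d = 1·[k-1,1] + 2·[k-1,2] + ⋯ + n_{k,d}·[k-1,n_{k,d}] + (n_{k,d}+1)·m_{k,d}`. -/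
def Nkd (k d : ℕ) : ℕ :=
  (∑ j ∈ Finset.Icc 1 (nkd k d), j * Nat.choose (k - 1 + j) j) + (nkd k d + 1) * mkd k d

/-- The exponent `c(k,d) = (d+1)/N_{k,d}`. -/
def ckd (k d : ℕ) : ℝ := (d + 1) / (Nkd k d)

/-- Directional derivative operator: `dirD v f x = Df(x)(v)`. -/
def dirD {E F : Type*} [NormedAddCommGroup E] [NormedSpace ℝ E]
    [NormedAddCommGroup F] [NormedSpace ℝ F] (v : E) (f : E → F) : E → F :=
  fun x => fderiv ℝ f x v

/-- Iterated partial derivative `∂^α` with respect to the directions `e i`,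
where direction `e i` is applied `α i` times. -/
def multiD {ι : Type*} [Fintype ι] {E F : Type*} [NormedAddCommGroup E] [NormedSpace ℝ E]
    [NormedAddCommGroup F] [NormedSpace ℝ F] (e : ι → E) (α : ι → ℕ) (f : E → F) : E → F :=
  (Finset.univ : Finset ι).toList.foldr (fun i g => (dirD (e i))^[α i] g) f

/-- The partial derivative `∂^α f` for a multi-index `α ∈ ℕ^k`. -/
def mderiv {k : ℕ} {F : Type*} [NormedAddCommGroup F] [NormedSpace ℝ F]
    (α : Fin k → ℕ) (f : (Fin k → ℝ) → F) : (Fin k → ℝ) → F :=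
  multiD (fun i => Pi.single i (1 : ℝ)) α f

/-- `Φ : U → M` is a `C^∞` local parameterization of the `k`-dimensional submanifold
`M ⊆ ℝ^d`: `U` is open, `Φ` is smooth and injective on `U` with everywhere injective
differential, and `Φ` is a homeomorphism of `U` onto a relatively open subset of `M`. -/
structure IsLocParam (k d : ℕ) (M : Set (Fin d → ℝ)) (U : Set (Fin k → ℝ))
    (Φ : (Fin k → ℝ) → (Fin d → ℝ)) : Prop where
  open_dom : IsOpen U
  smooth : ContDiffOn ℝ (⊤ : ℕ∞) Φ U
  inj : Set.InjOn Φ U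
  maps_to : Φ '' U ⊆ M
  immersion : ∀ v ∈ U, Function.Injective (fderiv ℝ Φ v)
  open_map : ∀ s : Set (Fin k → ℝ), IsOpen s →
    ∃ O : Set (Fin d → ℝ), IsOpen O ∧ Φ '' (s ∩ U) = O ∩ M

/-- `M ⊆ ℝ^d` is a `C^∞` submanifold of dimension `k`. -/
def IsSmoothSubmanifold (k d : ℕ) (M : Set (Fin d → ℝ)) : Prop :=
  ∀ x ∈ M, ∃ (U : Set (Fin k → ℝ)) (Φ : (Fin k → ℝ) → (Fin d → ℝ)),
    IsLocParam k d M U Φ ∧ x ∈ Φ '' U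

/-- `x ∈ M` is `D`-nondegenerate: for some local parameterization `Φ` with `Φ v = x`,
the partial derivatives `∂^α Φ(v)`, `0 < |α| ≤ D`, span `ℝ^d`. -/
def IsNondegAt (k d D : ℕ) (M : Set (Fin d → ℝ)) (x : Fin d → ℝ) : Prop :=
  ∃ (U : Set (Fin k → ℝ)) (Φ : (Fin k → ℝ) → (Fin d → ℝ)) (v : Fin k → ℝ),
    IsLocParam k d M U Φ ∧ v ∈ U ∧ Φ v = x ∧
    Submodule.span ℝ {y : Fin d → ℝ | ∃ α : Fin k → ℕ,
      0 < (∑ j, α j) ∧ (∑ j, α j) ≤ D ∧ y = mderiv α Φ v} = ⊤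

/-- `x ∈ M` is nondegenerate if it is `D`-nondegenerate for some `D`. -/
def IsNondeg (k d : ℕ) (M : Set (Fin d → ℝ)) (x : Fin d → ℝ) : Prop :=
  ∃ D : ℕ, IsNondegAt k d D M x

/-- The set `BA_M(ψ_c)` of `ψ_c`-badly intrinsically approximable points of `M`. -/
def BAset {d : ℕ} (M : Set (Fin d → ℝ)) (c : ℝ) : Set (Fin d → ℝ) :=
  {x ∈ M | ∃ κ > (0 : ℝ), ∀ r : Fin d → ℝ, IsRatPt r → r ∈ M →
    κ * (ht r : ℝ) ^ (-c) ≤ ‖x - r‖}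

/-- The set `VWA_M(ψ_c)` of `ψ_c`-very well intrinsically approximable points of `M`. -/
def VWAset {d : ℕ} (M : Set (Fin d → ℝ)) (c : ℝ) : Set (Fin d → ℝ) :=
  {x ∈ M | ∃ ε > (0 : ℝ),
    {r : Fin d → ℝ | IsRatPt r ∧ r ∈ M ∧ ‖x - r‖ ≤ (ht r : ℝ) ^ (-(c + ε))}.Infinite}

/-- `ψ` is a Dirichlet function for intrinsic approximation on `S ⊆ ℝ^m`. -/
def IsDirichletFn {m : ℕ} (S : Set (Fin m → ℝ)) (ψ : ℝ → ℝ) : Prop :=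
  (∀ t : ℝ, 0 < t → 0 < ψ t) ∧
  ∀ x ∈ S, ∃ C > (0 : ℝ), ∃ r : ℕ → (Fin m → ℝ),
    (∀ n, IsRatPt (r n) ∧ r n ∈ S) ∧ Filter.Tendsto r Filter.atTop (nhds x) ∧
    ∀ n, ‖x - r n‖ ≤ C * ψ (ht (r n))

/-- The closed `t`-neighborhood `S^{(t)}` of a set `S`. -/
def cnbhd {E : Type*} [PseudoMetricSpace E] (S : Set E) (t : ℝ) : Set E :=
  {x | ∃ y ∈ S, dist x y ≤ t}

/-- `x` belongs to the (topological) support of the measure `μ`. -/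
def InSupp {k : ℕ} (μ : Measure (Fin k → ℝ)) (x : Fin k → ℝ) : Prop :=
  ∀ ρ > (0 : ℝ), 0 < μ (ball x ρ)

/-- `μ` is absolutely decaying on `U`. -/
def AbsolutelyDecaying {k : ℕ} (μ : Measure (Fin k → ℝ)) (U : Set (Fin k → ℝ)) : Prop :=
  ∃ C > (0 : ℝ), ∃ a > (0 : ℝ), ∀ x, InSupp μ x → ∀ ρ : ℝ, 0 < ρ → ρ ≤ 1 →
    closedBall x ρ ⊆ U → ∀ ε > (0 : ℝ), ∀ (w : Fin k → ℝ) (b : ℝ), w ≠ 0 →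
      μ (cnbhd {y : Fin k → ℝ | ∑ j, w j * y j = b} (ε * ρ) ∩ closedBall x ρ) ≤
        ENNReal.ofReal (C * ε ^ a) * μ (closedBall x ρ)

/-- `μ` is doubling. -/
def IsDoubling {k : ℕ} (μ : Measure (Fin k → ℝ)) : Prop :=
  ∃ C > (0 : ℝ), ∀ x, InSupp μ x → ∀ ρ : ℝ, 0 < ρ → ρ ≤ 1 →
    μ (closedBall x (2 * ρ)) ≤ ENNReal.ofReal C * μ (closedBall x ρ)

/-- `μ` is absolutely friendly on `U`: absolutely decaying and doubling. -/
def AbsolutelyFriendly {k : ℕ} (μ : Measure (Fin k → ℝ)) (U : Set (Fin k → ℝ)) : Prop :=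
  AbsolutelyDecaying μ U ∧ IsDoubling μ

/-- The class `P_D` of polynomials of degree at most `D` whose coefficient of largest
absolute value has absolute value exactly `1`. -/
def IsPD (k D : ℕ) (p : MvPolynomial (Fin k) ℝ) : Prop :=
  p.totalDegree ≤ D ∧ (∀ m, |p.coeff m| ≤ 1) ∧ ∃ m, |p.coeff m| = 1

/-- Partial derivative within a set `s`, in the `i`-th coordinate direction. -/
def pderivW {k : ℕ} (s : Set (Fin k → ℝ)) (i : Fin k) (f : (Fin k → ℝ) → ℝ) :
    (Fin k → ℝ) → ℝ :=
  fun x => fderivWithin ℝ f s x (Pi.single i 1)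

/-- Iterated partial derivative `∂^α f` within a set `s`. -/
def mderivW {k : ℕ} (s : Set (Fin k → ℝ)) (α : Fin k → ℕ) (f : (Fin k → ℝ) → ℝ) :
    (Fin k → ℝ) → ℝ :=
  (List.finRange k).foldr (fun i g => (pderivW s i)^[α i] g) f

/-- The `C^D` norm `‖f‖_{C^D,B}` of `f` on `B`. -/
def CDnorm {k : ℕ} (D : ℕ) (B : Set (Fin k → ℝ)) (f : (Fin k → ℝ) → ℝ) : ℝ :=
  sSup {y : ℝ | ∃ α : Fin k → ℕ, (∑ j, α j) ≤ D ∧ ∃ x ∈ B, y = |mderivW B α f x|}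

/-- Analytic local parameterization. -/
structure IsAnalLocParam (k d : ℕ) (M : Set (Fin d → ℝ)) (U : Set (Fin k → ℝ))
    (Φ : (Fin k → ℝ) → (Fin d → ℝ)) : Prop where
  open_dom : IsOpen U
  analytic : AnalyticOnNhd ℝ Φ U
  inj : Set.InjOn Φ U
  maps_to : Φ '' U ⊆ M
  immersion : ∀ v ∈ U, Function.Injective (fderiv ℝ Φ v)
  open_map : ∀ s : Set (Fin k → ℝ), IsOpen s →
    ∃ O : Set (Fin d → ℝ), IsOpen O ∧ Φ '' (s ∩ U) = O ∩ M

/-- `M ⊆ ℝ^d` is a real-analytic submanifold of dimension `k`. -/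
def IsAnalSubmanifold (k d : ℕ) (M : Set (Fin d → ℝ)) : Prop :=
  ∀ x ∈ M, ∃ (U : Set (Fin k → ℝ)) (Φ : (Fin k → ℝ) → (Fin d → ℝ)),
    IsAnalLocParam k d M U Φ ∧ x ∈ Φ '' U

/-- `D`-nondegeneracy via an analytic local parameterization. -/
def IsAnalNondegAt (k d D : ℕ) (M : Set (Fin d → ℝ)) (x : Fin d → ℝ) : Prop :=
  ∃ (U : Set (Fin k → ℝ)) (Φ : (Fin k → ℝ) → (Fin d → ℝ)) (v : Fin k → ℝ),
    IsAnalLocParam k d M U Φ ∧ v ∈ U ∧ Φ v = x ∧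
    Submodule.span ℝ {y : Fin d → ℝ | ∃ α : Fin k → ℕ,
      0 < (∑ j, α j) ∧ (∑ j, α j) ≤ D ∧ y = mderiv α Φ v} = ⊤

/-- Nondegeneracy via an analytic local parameterization. -/
def IsAnalNondeg (k d : ℕ) (M : Set (Fin d → ℝ)) (x : Fin d → ℝ) : Prop :=
  ∃ D : ℕ, IsAnalNondegAt k d D M x

/-- A determinant whose rows are sums over a common finite index set of multiples of shared
vectors `c a`, plus a remainder: after multilinear expansion, the terms using some `c a` twice
vanish, and the others carry a total weight at least `N`. -/
lemma abs_det_le_of_weighted_rows {n ι : Type*} [Fintype n] [DecidableEq n] [Fintype ι]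
    (w : ι → ℕ) (w₀ N : ℕ) (c : ι → n → ℝ) (x : n → ι → ℝ) (R : n → n → ℝ) {K r : ℝ}
    (hr : 0 ≤ r) (hr1 : r ≤ 1) (hc : ∀ a, ‖c a‖ ≤ K)
    (hx : ∀ i a, |x i a| ≤ r ^ w a) (hR : ∀ i, ‖R i‖ ≤ K * r ^ w₀)
    (hN : ∀ q : n → Option ι, (∀ i j, i ≠ j → q i = q j → q i = none) →
      N ≤ ∑ i, (q i).elim w₀ w) (hK : 0 ≤ K) :
    |Matrix.det (Matrix.of fun i => R i + ∑ a, x i a • c a)| ≤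
      Fintype.card (n → Option ι) * ((Fintype.card n).factorial * K ^ Fintype.card n) * r ^ N := by
  classical
  let g : n → Option ι → n → ℝ := fun i o => o.elim (R i) fun a => x i a • c a
  have hrow : (Matrix.of fun i => R i + ∑ a, x i a • c a) = fun i => ∑ o, g i o := by
    ext i j
    simp [g, Fintype.sum_option]
  have hg : ∀ i o j, |g i o j| ≤ K * r ^ o.elim w₀ w := by
    intro i o j
    cases o with
    | none => exact (norm_le_pi_norm (R i) j).trans (hR i)
    | some a =>
      simp only [g, Option.elim_some, Pi.smul_apply, smul_eq_mul, abs_mul]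
      rw [mul_comm]
      exact mul_le_mul ((norm_le_pi_norm (c a) j).trans (hc a)) (hx i a) (abs_nonneg _) hK
  have hterm : ∀ q : n → Option ι, |Matrix.det (Matrix.of fun i => g i (q i))| ≤
      ((Fintype.card n).factorial * K ^ Fintype.card n) * r ^ N := by
    intro q
    by_cases hq : ∀ i j, i ≠ j → q i = q j → q i = none
    · calc |Matrix.det (Matrix.of fun i => g i (q i))|
          ≤ ∑ σ : Equiv.Perm n, ∏ i, (K * r ^ (q i).elim w₀ w) := by
            rw [Matrix.det_apply']
            refine (Finset.abs_sum_le_sum_abs _ _).trans (Finset.sum_le_sum fun σ _ => ?_)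
            rw [abs_mul, Finset.abs_prod, ← Equiv.prod_comp σ fun i => K * r ^ (q i).elim w₀ w]
            have hs : |((Equiv.Perm.sign σ : ℤ) : ℝ)| = 1 := by
              rcases Int.units_eq_one_or (Equiv.Perm.sign σ) with h | h <;> simp [h]
            rw [hs, one_mul]
            exact Finset.prod_le_prod (fun _ _ => abs_nonneg _) fun i _ => hg _ _ _
        _ = ((Fintype.card n).factorial * K ^ Fintype.card n) *
              r ^ ∑ i, (q i).elim w₀ w := by
            simp [Finset.prod_mul_distrib, Finset.prod_pow_eq_pow_sum, Fintype.card_perm, mul_assoc]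
        _ ≤ _ := mul_le_mul_of_nonneg_left (pow_le_pow_of_le_one hr hr1 (hN q hq)) (by positivity)
    · push Not at hq
      obtain ⟨i, j, hij, hqij, hne⟩ := hq
      obtain ⟨a, ha⟩ := Option.ne_none_iff_exists'.mp hne
      have hdet : Matrix.det (Matrix.of fun i => g i (q i)) = 0 := by
        by_contra hdet
        have hli : LinearIndependent ℝ (fun l => g l (q l)) :=
          Matrix.linearIndependent_rows_of_det_ne_zero hdet
        have hz := (linearIndependent_iff'.mp hli) {i, j}
          (fun l => if l = i then x j a else -x i a)
          (by
            rw [Finset.sum_pair hij]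
            simp [g, hij.symm, ← hqij, ha, smul_smul, mul_comm]) j (by simp)
        have hxi : x i a = 0 := by simpa [hij.symm] using hz
        exact hli.ne_zero i (by simp [g, ha, hxi])
      rw [hdet, abs_zero]
      positivity
  have hsum : Matrix.det (Matrix.of fun i => R i + ∑ a, x i a • c a) =
      ∑ q : n → Option ι, Matrix.det (Matrix.of fun i => g i (q i)) := by
    rw [hrow]
    exact (Matrix.detRowAlternating (R := ℝ) (n := n)).toMultilinearMap.map_sum g
  rw [hsum]
  refine (Finset.abs_sum_le_sum_abs _ _).trans ((Finset.sum_le_sum fun q _ => hterm q).trans ?_)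
  simp [mul_assoc]

/-- The multi-indices of order at most `n` in `k` variables, as unordered tuples of indices. -/
abbrev MultiIdx (k n : ℕ) : Type := Σ j : Fin (n + 1), Sym (Fin k) j

lemma sum_multiIdx_add (k d n : ℕ) (hk : 1 ≤ k) (hn : Ssum k n ≤ d) :
    ((∑ j ∈ Finset.Icc 1 n, j * Nat.choose (k - 1 + j) j) + (n + 1) * (d - Ssum k n)) +
      ∑ a : MultiIdx k n, (n + 1 - a.1) = (n + 1) * (d + 1) := by
  have hcard : ∀ j, Fintype.card (Sym (Fin k) j) = Nat.choose (k - 1 + j) j := fun j => by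
    rw [Sym.card_sym_eq_choose, Fintype.card_fin, show k + j - 1 = k - 1 + j by omega]
  have h1 : ∑ a : MultiIdx k n, (n + 1 - a.1 : ℕ) =
      (n + 1) + ∑ j ∈ Finset.Icc 1 n, (n + 1 - j) * Nat.choose (k - 1 + j) j := by
    rw [Fintype.sum_sigma]
    simp only [Finset.sum_const, Finset.card_univ, hcard, smul_eq_mul]
    rw [Fin.sum_univ_eq_sum_range (fun j => Nat.choose (k - 1 + j) j * (n + 1 - j)) (n + 1),
      Finset.range_eq_Ico, Finset.sum_eq_sum_Ico_succ_bot (by omega)]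
    simp [mul_comm, Finset.Ico_add_one_right_eq_Icc]
  have h2 : (∑ j ∈ Finset.Icc 1 n, j * Nat.choose (k - 1 + j) j) +
      ∑ j ∈ Finset.Icc 1 n, (n + 1 - j) * Nat.choose (k - 1 + j) j = (n + 1) * Ssum k n := by
    rw [← Finset.sum_add_distrib, Ssum, Finset.mul_sum]
    refine Finset.sum_congr rfl fun j hj => ?_
    rw [← add_mul]
    congr 1
    have := Finset.mem_Icc.mp hj
    omega
  obtain ⟨e, rfl⟩ := Nat.exists_eq_add_of_le hn
  rw [h1, Nat.add_sub_cancel_left]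
  linarith

lemma Ssum_nkd_le (k d : ℕ) : Ssum k (nkd k d) ≤ d := by
  refine Nat.sSup_mem (s := {n | Ssum k n ≤ d}) ⟨0, by simp [Ssum]⟩ ⟨d, fun n hn => ?_⟩
  refine le_trans ?_ hn
  calc n = ∑ j ∈ Finset.Icc 1 n, 1 := by simp
    _ ≤ Ssum k n := Finset.sum_le_sum fun j _ => Nat.choose_pos (by omega)

/-- Choosing `d + 1` multi-indices of order at most `n`, distinct unless replaced by a remainder
of weight `n + 1`, gives total weight at least that of the `d + 1` lightest choices. -/
lemma weight_le_sum_elim (k d n : ℕ) (hk : 1 ≤ k) (hn : Ssum k n ≤ d)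
    (q : Fin (d + 1) → Option (MultiIdx k n)) (hq : ∀ i j, i ≠ j → q i = q j → q i = none) :
    (∑ j ∈ Finset.Icc 1 n, j * Nat.choose (k - 1 + j) j) + (n + 1) * (d - Ssum k n) ≤
      ∑ i, (q i).elim (n + 1) fun a => (a.1 : ℕ) := by
  classical
  let v : Option (MultiIdx k n) → ℕ := fun o => o.elim 0 fun a => n + 1 - a.1
  have hv : ∑ i, v (q i) ≤ ∑ a : MultiIdx k n, (n + 1 - a.1) := by
    have h1 : ∀ i, v (q i) = ∑ a : MultiIdx k n, if q i = some a then n + 1 - (a.1 : ℕ) else 0 := by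
      intro i
      cases h : q i <;> simp [v]
    simp_rw [h1]
    rw [Finset.sum_comm]
    refine Finset.sum_le_sum fun a _ => ?_
    rw [← Finset.sum_filter, Finset.sum_const, smul_eq_mul]
    refine mul_le_of_le_one_left (Nat.zero_le _) (Finset.card_le_one.mpr fun i hi j hj => ?_)
    simp only [Finset.mem_filter, Finset.mem_univ, true_and] at hi hj
    by_contra hij
    simpa [hi] using hq i j hij (hi.trans hj.symm)
  have hsum : ∑ i, v (q i) + ∑ i, (q i).elim (n + 1) (fun a => (a.1 : ℕ)) = (n + 1) * (d + 1) := by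
    rw [← Finset.sum_add_distrib, Finset.sum_congr rfl (g := fun _ => n + 1)]
    · simp [mul_comm]
    · intro i _
      cases h : q i with
      | none => simp [v]
      | some a =>
        have := a.1.2
        simp only [v, Option.elim_some]
        omega
  have := sum_multiIdx_add k d n hk hn
  omega

/-- The unordered tuple of values of `f`. -/
def symOfFn {k j : ℕ} (f : Fin j → Fin k) : Sym (Fin k) j :=
  ⟨Finset.univ.val.map f, by simp⟩

section Taylor

variable {F : Type*} [NormedAddCommGroup F] [NormedSpace ℝ F]

/-- The coefficient of the monomial `m` in the homogeneous polynomial `h ↦ D (h, …, h)`. -/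
def diagCoeff {k j : ℕ} (D : (Fin k → ℝ) [×j]→L[ℝ] F) (m : Sym (Fin k) j) : F :=
  ∑ f : Fin j → Fin k with symOfFn f = m, D fun i => Pi.single (f i) 1

lemma apply_diag_eq_sum {k j : ℕ} (D : (Fin k → ℝ) [×j]→L[ℝ] F) (h : Fin k → ℝ) :
    D (fun _ => h) = ∑ m : Sym (Fin k) j, ((m : Multiset (Fin k)).map h).prod • diagCoeff D m := by
  have hh : h = ∑ l, h l • (Pi.single l 1 : Fin k → ℝ) := by
    simpa using (pi_eq_sum_univ' h)
  conv_lhs => rw [hh]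
  have hexp := D.toMultilinearMap.map_sum fun (_ : Fin j) l => h l • (Pi.single l 1 : Fin k → ℝ)
  refine hexp.trans ?_
  rw [← Finset.sum_fiberwise_of_maps_to (t := Finset.univ) (g := symOfFn) fun _ _ =>
    Finset.mem_univ _]
  refine Finset.sum_congr rfl fun m _ => ?_
  rw [diagCoeff, Finset.smul_sum]
  refine Finset.sum_congr rfl fun f hf => ?_
  obtain rfl := (Finset.mem_filter.mp hf).2
  rw [MultilinearMap.map_smul_univ]
  simp [symOfFn, Function.comp_def, List.prod_ofFn]

lemma norm_diagCoeff_le {k j : ℕ} (D : (Fin k → ℝ) [×j]→L[ℝ] F) (m : Sym (Fin k) j) :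
    ‖diagCoeff D m‖ ≤ Fintype.card (Fin j → Fin k) * ‖D‖ := by
  refine (norm_sum_le_of_le _ (n := fun _ => ‖D‖) fun f _ => ?_).trans ?_
  · refine (D.le_opNorm _).trans_eq ?_
    simp [Pi.norm_single]
  · rw [Finset.sum_const, nsmul_eq_mul]
    gcongr
    exact Finset.card_le_univ _

lemma abs_monomial_le {k j : ℕ} (m : Sym (Fin k) j) {h : Fin k → ℝ} {r : ℝ} (hr : ‖h‖ ≤ r) :
    |((m : Multiset (Fin k)).map h).prod| ≤ r ^ j := by
  obtain ⟨m, rfl⟩ := m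
  change |(m.map h).prod| ≤ r ^ m.card
  induction m using Multiset.induction_on with
  | empty => simp
  | cons a m ih =>
    rw [Multiset.map_cons, Multiset.prod_cons, Multiset.card_cons, abs_mul, pow_succ']
    have ha : |h a| ≤ r := (norm_le_pi_norm h a).trans hr
    exact mul_le_mul ha ih (abs_nonneg _) ((abs_nonneg _).trans ha)

/-- Taylor's formula with uniform constants on a compact set, in terms of monomials. -/
lemma exists_uniform_taylor [CompleteSpace F] {k : ℕ} {U V : Set (Fin k → ℝ)} (hU : IsOpen U)
    {f : (Fin k → ℝ) → F} (hf : ContDiffOn ℝ (⊤ : ℕ∞) f U) (hV : IsCompact V) (hVU : V ⊆ U)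
    (n : ℕ) :
    ∃ δ > 0, ∃ K ≥ 0, ∀ x ∈ V, ∃ c : MultiIdx k n → F, (∀ a, ‖c a‖ ≤ K) ∧
      ∀ h : Fin k → ℝ, ‖h‖ ≤ δ →
        ‖f (x + h) - ∑ a, ((a.2 : Multiset (Fin k)).map h).prod • c a‖ ≤ K * ‖h‖ ^ (n + 1) := by
  obtain ⟨δ, hδ, hδU⟩ := hV.exists_cthickening_subset_open hU hVU
  have hW : IsCompact (cthickening δ V) := hV.cthickening
  have hVW : V ⊆ cthickening δ V := self_subset_cthickening V
  have hat : ∀ x ∈ U, ContDiffAt ℝ (⊤ : ℕ∞) f x := fun x hx => hf.contDiffAt (hU.mem_nhds hx)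
  have hcont : ∀ j : ℕ, ContinuousOn (iteratedFDeriv ℝ j f) (cthickening δ V) := fun j x hx =>
    ((hat x (hδU hx)).iteratedFDeriv_right (i := j) (m := 0)
      (by norm_cast; exact le_top)).continuousAt.continuousWithinAt
  choose B hB using fun j => hW.exists_bound_of_continuousOn (hcont j)
  let b : ℕ → ℝ := fun j => Fintype.card (Fin j → Fin k) * |B j|
  have hb : ∀ j, 0 ≤ b j := fun j => by positivity
  refine ⟨δ, hδ, |B (n + 1)| + ∑ j ∈ Finset.range (n + 1), b j,
    add_nonneg (abs_nonneg _) (Finset.sum_nonneg fun j _ => hb j), fun x hx =>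
    ⟨fun a => ((a.1 : ℕ).factorial : ℝ)⁻¹ • diagCoeff (iteratedFDeriv ℝ a.1 f x) a.2, ?_, ?_⟩⟩
  · rintro ⟨j, m⟩
    have h1 : ‖((j : ℕ).factorial : ℝ)⁻¹‖ ≤ 1 := by
      rw [norm_inv, Real.norm_natCast]
      exact inv_le_one_of_one_le₀ (mod_cast Nat.factorial_pos _)
    calc ‖((j : ℕ).factorial : ℝ)⁻¹ • diagCoeff (iteratedFDeriv ℝ j f x) m‖
        ≤ ‖diagCoeff (iteratedFDeriv ℝ j f x) m‖ := by
          rw [norm_smul]; exact mul_le_of_le_one_left (norm_nonneg _) h1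
      _ ≤ b j := (norm_diagCoeff_le _ _).trans <| by
          exact mul_le_mul_of_nonneg_left ((hB j x (hVW hx)).trans (le_abs_self _))
            (Nat.cast_nonneg _)
      _ ≤ ∑ j ∈ Finset.range (n + 1), b j :=
          Finset.single_le_sum (fun j _ => hb j) (Finset.mem_range.mpr j.2)
      _ ≤ _ := le_add_of_nonneg_left (abs_nonneg _)
  · intro h hh
    have hseg : ∀ t ∈ Icc (0 : ℝ) 1, x + t • h ∈ cthickening δ V := fun t ht => by
      refine mem_cthickening_of_dist_le _ x _ _ hx ?_
      rw [dist_self_add_left, norm_smul, Real.norm_of_nonneg ht.1]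
      exact (mul_le_of_le_one_left (norm_nonneg _) ht.2).trans hh
    rw [map_add_eq_sum_add_integral_iteratedFDeriv (n := n) fun t ht =>
      (hat _ (hδU (hseg t ht))).of_le (by norm_cast; exact le_top)]
    have hpoly : ∑ j ∈ Finset.range (n + 1),
        (j.factorial : ℝ)⁻¹ • iteratedFDeriv ℝ j f x (fun _ => h) =
        ∑ a : MultiIdx k n, ((a.2 : Multiset (Fin k)).map h).prod •
          ((a.1 : ℕ).factorial : ℝ)⁻¹ • diagCoeff (iteratedFDeriv ℝ a.1 f x) a.2 := by
      rw [Fintype.sum_sigma, ← Fin.sum_univ_eq_sum_range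
        (fun j => (j.factorial : ℝ)⁻¹ • iteratedFDeriv ℝ j f x (fun _ => h))]
      refine Finset.sum_congr rfl fun j _ => ?_
      rw [apply_diag_eq_sum, Finset.smul_sum]
      exact Finset.sum_congr rfl fun m _ => smul_comm _ _ _
    rw [hpoly, add_sub_cancel_left, norm_smul]
    have h1 : ‖(n.factorial : ℝ)⁻¹‖ ≤ 1 := by
      rw [norm_inv, Real.norm_natCast]
      exact inv_le_one_of_one_le₀ (mod_cast Nat.factorial_pos _)
    have hint : ‖∫ t in (0 : ℝ)..1, (1 - t) ^ n •
        iteratedFDeriv ℝ (n + 1) f (x + t • h) (fun _ => h)‖ ≤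
        |B (n + 1)| * ‖h‖ ^ (n + 1) * |1 - 0| := by
      refine intervalIntegral.norm_integral_le_of_norm_le_const fun t ht => ?_
      rw [uIoc_of_le zero_le_one] at ht
      rw [norm_smul, norm_pow, Real.norm_of_nonneg (sub_nonneg.mpr ht.2)]
      refine (mul_le_of_le_one_left (norm_nonneg _)
        (pow_le_one₀ (sub_nonneg.mpr ht.2) (by linarith [ht.1]))).trans ?_
      refine (ContinuousMultilinearMap.le_opNorm _ _).trans ?_
      rw [Finset.prod_const, Finset.card_univ, Fintype.card_fin]
      gcongr
      exact (hB _ _ (hseg t ⟨ht.1.le, ht.2⟩)).trans (le_abs_self _)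
    refine (mul_le_of_le_one_left (norm_nonneg _) h1).trans (hint.trans ?_)
    rw [sub_zero, abs_one, mul_one]
    gcongr
    exact le_add_of_nonneg_right (Finset.sum_nonneg fun j _ => hb j)

end Taylor

/-- The matrix `[Φ(s_1) ⋯ Φ(s_{d+1})]` has small determinant when the `s_i` are close together. -/
lemma exists_abs_det_le_of_dist_le {k d : ℕ} (hk : 1 ≤ k) {U V : Set (Fin k → ℝ)} (hU : IsOpen U)
    {Φ : (Fin k → ℝ) → Fin (d + 1) → ℝ} (hΦ : ContDiffOn ℝ (⊤ : ℕ∞) Φ U) (hV : IsCompact V)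
    (hVU : V ⊆ U) :
    ∃ δ > 0, ∃ C ≥ 0, ∀ s : Fin (d + 1) → Fin k → ℝ, (∀ i, s i ∈ V) → ∀ r, 0 ≤ r → r ≤ δ →
      (∀ i, ‖s i - s 0‖ ≤ r) → |Matrix.det (Matrix.of fun i => Φ (s i))| ≤ C * r ^ Nkd k d := by
  obtain ⟨δ, hδ, K, hK, hT⟩ := exists_uniform_taylor hU hΦ hV hVU (nkd k d)
  refine ⟨min δ 1, by positivity,
    Fintype.card (Fin (d + 1) → Option (MultiIdx k (nkd k d))) *
      ((Fintype.card (Fin (d + 1))).factorial * K ^ Fintype.card (Fin (d + 1))),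
    by positivity, fun s hs r hr hrδ hsr => ?_⟩
  obtain ⟨c, hc, hrem⟩ := hT (s 0) (hs 0)
  let x : Fin (d + 1) → MultiIdx k (nkd k d) → ℝ := fun i a =>
    ((a.2 : Multiset (Fin k)).map (s i - s 0)).prod
  have h := abs_det_le_of_weighted_rows (fun a : MultiIdx k (nkd k d) => (a.1 : ℕ))
    (nkd k d + 1) (Nkd k d) c x (fun i => Φ (s i) - ∑ a, x i a • c a) hr
    (hrδ.trans (min_le_right _ _)) hc (fun i a => abs_monomial_le a.2 (hsr i))
    (fun i => ?_) (weight_le_sum_elim k d _ hk (Ssum_nkd_le k d)) hK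
  · simpa only [sub_add_cancel] using h
  · have := hrem (s i - s 0) ((hsr i).trans (hrδ.trans (min_le_left _ _)))
    rw [add_sub_cancel] at this
    refine this.trans ?_
    gcongr
    exact hsr i

lemma norm_sub_le_two_mul_infDist {ι E : Type*} [Fintype ι] [NormedAddCommGroup E]
    {U : Set E} (hU : U.Nonempty) (s : ι → E) (i j : ι) :
    ‖s i - s j‖ ≤ 2 * infDist s {x | ∃ t ∈ U, x = fun _ => t} := by
  have hne : {x : ι → E | ∃ t ∈ U, x = fun _ => t}.Nonempty :=
    hU.elim fun t ht => ⟨_, t, ht, rfl⟩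
  suffices ‖s i - s j‖ / 2 ≤ infDist s {x | ∃ t ∈ U, x = fun _ => t} by linarith
  refine (le_infDist hne).mpr ?_
  rintro _ ⟨t, -, rfl⟩
  have hi : dist (s i) t ≤ dist s fun _ => t := dist_le_pi_dist s (fun _ => t) i
  have hj : dist (s j) t ≤ dist s fun _ => t := dist_le_pi_dist s (fun _ => t) j
  have := dist_triangle_right (s i) (s j) t
  rw [dist_eq_norm (s i)] at this
  linarith

/-- **Taylor-type estimate for the determinant near the diagonal.**
With `Φ(s) = (1, Ψ(s))` and `f(s_1,…,s_{d+1}) = det[Φ(s_1) ⋯ Φ(s_{d+1})]`, there is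
`C > 0` with `|f(s_1,…,s_{d+1})| ≤ C·dist((s_i)_i, Δ)^{N_{k,d}}` for all `s_i ∈ V`. -/
theorem determinant_diagonal_bound (k d : ℕ) (hk : 1 ≤ k) (hkd : k ≤ d)
    (U : Set (Fin k → ℝ)) (hU : IsOpen U)
    (Ψ : (Fin k → ℝ) → (Fin d → ℝ)) (hΨ : ContDiffOn ℝ (⊤ : ℕ∞) Ψ U)
    (V : Set (Fin k → ℝ)) (hV : IsCompact V) (hVU : V ⊆ U) :
    ∃ C > (0 : ℝ), ∀ s : Fin (d + 1) → (Fin k → ℝ), (∀ i, s i ∈ V) →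
      |Matrix.det (Matrix.of fun i j => Fin.cons (1 : ℝ) (Ψ (s j)) i)| ≤
        C * (Metric.infDist s
              {x : Fin (d + 1) → Fin k → ℝ | ∃ t ∈ U, x = fun _ => t}) ^ (Nkd k d) := by
  let Φ : (Fin k → ℝ) → Fin (d + 1) → ℝ := fun x => Fin.cons 1 (Ψ x)
  have hΦ : ContDiffOn ℝ (⊤ : ℕ∞) Φ U := contDiffOn_pi.mpr fun i => by
    refine Fin.cases ?_ (fun i => ?_) i
    · exact contDiffOn_const
    · exact contDiffOn_pi.mp hΨ i
  have htr : ∀ s : Fin (d + 1) → Fin k → ℝ,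
      Matrix.det (Matrix.of fun i j => (Fin.cons (1 : ℝ) (Ψ (s j)) : Fin (d + 1) → ℝ) i) =
        Matrix.det (Matrix.of fun i => Φ (s i)) := fun s =>
    (Matrix.det_transpose (Matrix.of fun i => Φ (s i)))
  obtain ⟨δ, hδ, C, hC, hnear⟩ := exists_abs_det_le_of_dist_le hk hU hΦ hV hVU
  obtain ⟨B, hB⟩ := hV.exists_bound_of_continuousOn (hΦ.continuousOn.mono hVU)
  have hfar : ∀ s : Fin (d + 1) → Fin k → ℝ, (∀ i, s i ∈ V) →
      |Matrix.det (Matrix.of fun i => Φ (s i))| ≤ (d + 1).factorial • |B| ^ (d + 1) := by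
    intro s hs
    simpa using Matrix.det_le (A := Matrix.of fun i => Φ (s i)) (abv := AbsoluteValue.abs)
      (x := |B|) fun i j =>
        (norm_le_pi_norm (Φ (s i)) j).trans ((hB _ (hs i)).trans (le_abs_self _))
  set M : ℝ := (d + 1).factorial • |B| ^ (d + 1)
  have hM0 : 0 ≤ M := by positivity
  refine ⟨C * 2 ^ Nkd k d + M * (2 / δ) ^ Nkd k d + 1, by positivity, fun s hs => ?_⟩
  rw [htr]
  have hdist := norm_sub_le_two_mul_infDist ⟨s 0, hVU (hs 0)⟩ s
  set D := infDist s {x : Fin (d + 1) → Fin k → ℝ | ∃ t ∈ U, x = fun _ => t}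
  have hD : 0 ≤ D := infDist_nonneg
  by_cases hDδ : 2 * D ≤ δ
  · calc |Matrix.det (Matrix.of fun i => Φ (s i))| ≤ C * (2 * D) ^ Nkd k d :=
          hnear s hs _ (by positivity) hDδ fun i => hdist i 0
      _ = C * 2 ^ Nkd k d * D ^ Nkd k d := by rw [mul_pow, mul_assoc]
      _ ≤ _ := by
          gcongr
          have : 0 ≤ M * (2 / δ) ^ Nkd k d := by positivity
          linarith
  · have h1 : 1 ≤ 2 / δ * D := by
      rw [div_mul_eq_mul_div, one_le_div hδ]
      exact (not_le.mp hDδ).le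
    calc |Matrix.det (Matrix.of fun i => Φ (s i))| ≤ M := hfar s hs
      _ ≤ M * (2 / δ * D) ^ Nkd k d := le_mul_of_one_le_right hM0 (one_le_pow₀ h1)
      _ = M * (2 / δ) ^ Nkd k d * D ^ Nkd k d := by rw [mul_pow, mul_assoc]
      _ ≤ _ := by
          gcongr
          have : 0 ≤ C * 2 ^ Nkd k d := by positivity
          linarith
end
end

section
/- Let M ⊆ ℝ^d be a connected real-analytic submanifold of dimension k. If M is not contained in any affine hyperplane of ℝ^d, then every point of M is nondegenerate. -/
open Set Filter Metric MeasureTheory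
noncomputable section

open scoped Topology

section DirectionalDerivatives

variable {E F : Type*} [NormedAddCommGroup E] [NormedSpace ℝ E]
  [NormedAddCommGroup F] [NormedSpace ℝ F]

theorem dirD_eqOn {U : Set E} (hU : IsOpen U) {f g : E → F} (h : EqOn f g U) (v : E) :
    EqOn (dirD v f) (dirD v g) U := fun x hx => by
  simp only [dirD, (h.eventuallyEq_of_mem (hU.mem_nhds hx)).fderiv_eq]

theorem dirD_iterate_eqOn {U : Set E} (hU : IsOpen U) {f g : E → F} (h : EqOn f g U)
    (v : E) (n : ℕ) : EqOn ((dirD v)^[n] f) ((dirD v)^[n] g) U := by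
  induction n with
  | zero => exact h
  | succ n ih =>
    simp only [Function.iterate_succ_apply']
    exact dirD_eqOn hU ih v

theorem AnalyticOnNhd.dirD [CompleteSpace F] {U : Set E} {f : E → F}
    (hf : AnalyticOnNhd ℝ f U) (v : E) : AnalyticOnNhd ℝ (dirD v f) U := fun x hx =>
  (ContinuousLinearMap.apply ℝ F v).analyticAt _ |>.comp (hf.fderiv x hx)

theorem AnalyticOnNhd.dirD_iterate [CompleteSpace F] {U : Set E} {f : E → F}
    (hf : AnalyticOnNhd ℝ f U) (v : E) (n : ℕ) : AnalyticOnNhd ℝ ((_root_.dirD v)^[n] f) U := by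
  induction n with
  | zero => exact hf
  | succ n ih =>
    simp only [Function.iterate_succ_apply']
    exact ih.dirD v

theorem dirD_comm [CompleteSpace F] {U : Set E} {f : E → F}
    (hf : AnalyticOnNhd ℝ f U) (v w : E) :
    EqOn (dirD v (dirD w f)) (dirD w (dirD v f)) U := fun x hx => by
  have hd : DifferentiableAt ℝ (fderiv ℝ f) x := (hf.fderiv x hx).differentiableAt
  have hsymm : IsSymmSndFDerivAt ℝ f x := (hf x hx).contDiffAt.isSymmSndFDerivAt_of_omega
  have key : ∀ a b : E, dirD a (dirD b f) x = fderiv ℝ (fderiv ℝ f) x a b := fun a b => by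
    have h : HasFDerivAt (dirD b f) _ x := hd.hasFDerivAt.clm_apply (hasFDerivAt_const b x)
    rw [dirD, h.fderiv]
    simp
  rw [key, key, hsymm]

theorem dirD_iterate_comm [CompleteSpace F] {U : Set E} (hU : IsOpen U) {f : E → F}
    (hf : AnalyticOnNhd ℝ f U) (v w : E) (n : ℕ) :
    EqOn (dirD v ((dirD w)^[n] f)) ((dirD w)^[n] (dirD v f)) U := by
  induction n with
  | zero => exact fun _ _ => rfl
  | succ n ih =>
    simp only [Function.iterate_succ_apply']
    exact (dirD_comm (hf.dirD_iterate w n) v w).trans (dirD_eqOn hU ih w)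

variable {ι : Type*} (e : ι → E)

theorem AnalyticOnNhd.foldr_dirD [CompleteSpace F] {U : Set E} {f : E → F}
    (hf : AnalyticOnNhd ℝ f U) (α : ι → ℕ) (l : List ι) :
    AnalyticOnNhd ℝ (l.foldr (fun i g => (_root_.dirD (e i))^[α i] g) f) U := by
  induction l with
  | nil => exact hf
  | cons i l ih => exact ih.dirD_iterate _ _

theorem foldr_dirD_congr {α β : ι → ℕ} {l : List ι} (h : ∀ i ∈ l, α i = β i) (f : E → F) :
    l.foldr (fun i g => (dirD (e i))^[α i] g) f = l.foldr (fun i g => (dirD (e i))^[β i] g) f := by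
  induction l with
  | nil => rfl
  | cons i l ih =>
    simp only [List.foldr_cons]
    rw [ih fun j hj => h j (List.mem_cons_of_mem _ hj), h i List.mem_cons_self]

theorem dirD_foldr_dirD [DecidableEq ι] [CompleteSpace F] {U : Set E} (hU : IsOpen U) {f : E → F}
    (hf : AnalyticOnNhd ℝ f U) (α : ι → ℕ) {l : List ι} (hl : l.Nodup) {i : ι} (hi : i ∈ l) :
    EqOn (dirD (e i) (l.foldr (fun j g => (dirD (e j))^[α j] g) f))
      (l.foldr (fun j g => (dirD (e j))^[(α + Pi.single i 1 : ι → ℕ) j] g) f) U := by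
  induction l with
  | nil => simp at hi
  | cons j l ih =>
    obtain ⟨hjl, hl⟩ := List.nodup_cons.mp hl
    simp only [List.foldr_cons]
    rcases eq_or_ne i j with rfl | hij
    · rw [foldr_dirD_congr e (α := α + Pi.single i 1) (β := α)]
      · simp only [Pi.add_apply, Pi.single_eq_same, Function.iterate_succ_apply']
        exact fun _ _ => rfl
      · intro m hm
        have : m ≠ i := fun h => hjl (h ▸ hm)
        simp [this]
    · have hil : i ∈ l := (List.mem_cons.mp hi).resolve_left hij
      have hα : (α + Pi.single i 1 : ι → ℕ) j = α j := by simp [hij.symm]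
      rw [hα]
      exact (dirD_iterate_comm hU (hf.foldr_dirD e α l) _ _ _).trans
        (dirD_iterate_eqOn hU (ih hl hil) _ _)

theorem dirD_multiD [Fintype ι] [DecidableEq ι] [CompleteSpace F] {U : Set E} (hU : IsOpen U)
    {f : E → F} (hf : AnalyticOnNhd ℝ f U) (α : ι → ℕ) (i : ι) :
    EqOn (dirD (e i) (multiD e α f)) (multiD e (α + Pi.single i 1) f) U :=
  dirD_foldr_dirD e hU hf α (Finset.nodup_toList _)
    (Finset.mem_toList.mpr (Finset.mem_univ i))

theorem multiD_zero [Fintype ι] (f : E → F) : multiD e 0 f = f := by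
  simp [multiD]

theorem exists_multiD_eqOn_iteratedFDeriv [Fintype ι] [CompleteSpace F] {U : Set E}
    (hU : IsOpen U) {f : E → F} (hf : AnalyticOnNhd ℝ f U) (n : ℕ) (s : Fin n → ι) :
    ∃ α : ι → ℕ, ∑ i, α i = n ∧
      EqOn (fun x => iteratedFDeriv ℝ n f x fun j => e (s j)) (multiD e α f) U := by
  classical
  induction n with
  | zero => exact ⟨0, by simp, fun x _ => by simp [multiD_zero]⟩
  | succ n ih =>
    obtain ⟨α, hα, h⟩ := ih fun j => s j.succ
    refine ⟨α + Pi.single (s 0) 1, by simp [Finset.sum_add_distrib, hα], fun x hx => ?_⟩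
    rw [← dirD_multiD e hU hf α (s 0) hx, ← dirD_eqOn hU h _ hx]
    have hd : DifferentiableAt ℝ (iteratedFDeriv ℝ n f) x :=
      (hf.iteratedFDeriv n x hx).differentiableAt
    simp only [dirD, iteratedFDeriv_succ_apply_left]
    rw [fderiv_continuousMultilinear_apply_const_apply hd]
    rfl

end DirectionalDerivatives

theorem eventually_eq_of_mderiv_eq_zero {k : ℕ} {F : Type*} [NormedAddCommGroup F]
    [NormedSpace ℝ F] [CompleteSpace F] {U : Set (Fin k → ℝ)} (hU : IsOpen U)
    {f : (Fin k → ℝ) → F} (hf : AnalyticOnNhd ℝ f U) {v : Fin k → ℝ} (hv : v ∈ U)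
    (L : F →L[ℝ] ℝ) (h : ∀ α : Fin k → ℕ, 0 < ∑ j, α j → L (mderiv α f v) = 0) :
    ∀ᶠ u in 𝓝 v, L (f u) = L (f v) := by
  have hzero : ∀ n, n ≠ 0 →
      (L.compContinuousMultilinearMap (iteratedFDeriv ℝ n f v)).toMultilinearMap = 0 := by
    intro n hn
    refine Module.Basis.ext_multilinear (fun _ => Pi.basisFun ℝ (Fin k)) fun s => ?_
    obtain ⟨α, hα, heq⟩ := exists_multiD_eqOn_iteratedFDeriv
      (fun i : Fin k => (Pi.single i (1 : ℝ) : Fin k → ℝ)) hU hf n s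
    have := h α (by omega)
    rw [mderiv, ← heq hv] at this
    simpa using this
  obtain ⟨p, r, hp⟩ := hf v hv
  have hball : ∀ᶠ u in 𝓝 v, u - v ∈ Metric.eball (0 : Fin k → ℝ) r := by
    have : Tendsto (fun u => u - v) (𝓝 v) (𝓝 0) := by
      simpa using (continuous_id.sub continuous_const).tendsto (f := fun u => u - v) v
    exact this (Metric.eball_mem_nhds _ hp.r_pos)
  filter_upwards [hball] with u hu
  have hsum := (hp.hasSum_iteratedFDeriv hu).mapL L
  rw [add_sub_cancel] at hsum
  refine hsum.unique ?_
  convert hasSum_single (α := ℝ) 0 fun n hn => ?_ using 1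
  · simp
  · have := congrArg (fun m => m fun _ => u - v) (hzero n hn)
    simp only [map_smul]
    exact smul_eq_zero_of_right _ this

theorem exists_linear_functional_of_not_isAnalNondeg {k d : ℕ} {M : Set (Fin d → ℝ)}
    {U : Set (Fin k → ℝ)} {Φ : (Fin k → ℝ) → (Fin d → ℝ)} (hΦ : IsAnalLocParam k d M U Φ)
    {v : Fin k → ℝ} (hv : v ∈ U) (h : ¬ IsAnalNondeg k d M (Φ v)) :
    ∃ L : (Fin d → ℝ) →L[ℝ] ℝ, L ≠ 0 ∧
      ∀ α : Fin k → ℕ, 0 < ∑ j, α j → L (mderiv α Φ v) = 0 := by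
  let S : ℕ →o Submodule ℝ (Fin d → ℝ) :=
    { toFun := fun D => Submodule.span ℝ {y : Fin d → ℝ | ∃ α : Fin k → ℕ,
        0 < (∑ j, α j) ∧ (∑ j, α j) ≤ D ∧ y = mderiv α Φ v}
      monotone' := fun D D' hD => Submodule.span_mono
        fun y ⟨α, h0, h1, h2⟩ => ⟨α, h0, h1.trans hD, h2⟩ }
  obtain ⟨D, hD⟩ := monotone_stabilizes_iff_noetherian.mpr
    (inferInstance : IsNoetherian ℝ (Fin d → ℝ)) S
  have hne : S D ≠ ⊤ := fun htop => h ⟨D, U, Φ, v, hΦ, hv, rfl, htop⟩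
  obtain ⟨L, hL, hker⟩ := Submodule.exists_le_ker_of_lt_top _ hne.lt_top
  refine ⟨L.toContinuousLinearMap, by simpa using hL, fun α hα => ?_⟩
  have hmem : mderiv α Φ v ∈ S (max D (∑ j, α j)) :=
    Submodule.subset_span ⟨α, hα, le_max_right _ _, rfl⟩
  rw [← hD _ (le_max_left _ _)] at hmem
  exact hker hmem

theorem IsAnalLocParam.eventually_nhds_of_nhdsWithin {k d : ℕ} {M : Set (Fin d → ℝ)}
    {U : Set (Fin k → ℝ)} {Φ : (Fin k → ℝ) → (Fin d → ℝ)} (hΦ : IsAnalLocParam k d M U Φ)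
    {v : Fin k → ℝ} (hv : v ∈ U) {p : (Fin d → ℝ) → Prop} (h : ∀ᶠ y in 𝓝[M] (Φ v), p y) :
    ∀ᶠ u in 𝓝 v, p (Φ u) := by
  refine Tendsto.eventually (tendsto_nhdsWithin_iff.mpr ⟨(hΦ.analytic v hv).continuousAt, ?_⟩) h
  filter_upwards [hΦ.open_dom.mem_nhds hv] with u hu using hΦ.maps_to (mem_image_of_mem Φ hu)

theorem IsAnalLocParam.image_mem_nhdsWithin {k d : ℕ} {M : Set (Fin d → ℝ)}
    {U : Set (Fin k → ℝ)} {Φ : (Fin k → ℝ) → (Fin d → ℝ)} (hΦ : IsAnalLocParam k d M U Φ)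
    {v : Fin k → ℝ} (hv : v ∈ U) {s : Set (Fin k → ℝ)} (hs : s ∈ 𝓝 v) :
    Φ '' s ∈ 𝓝[M] (Φ v) := by
  obtain ⟨t, hts, ht, hvt⟩ := _root_.mem_nhds_iff.mp hs
  obtain ⟨O, hO, hOM⟩ := hΦ.open_map t ht
  have hvO : Φ v ∈ O ∩ M := hOM ▸ mem_image_of_mem Φ ⟨hvt, hv⟩
  refine mem_nhdsWithin.mpr ⟨O, hO, hvO.1, ?_⟩
  rw [← hOM]
  exact image_mono (inter_subset_left.trans hts)

/-- Identity principle: a linear functional which is constant near one point of a connected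
real-analytic submanifold is constant on the whole submanifold. -/
theorem IsAnalSubmanifold.eq_of_eventually_eq {k d : ℕ} {M : Set (Fin d → ℝ)}
    (hM : IsAnalSubmanifold k d M) (hconn : IsConnected M) (L : (Fin d → ℝ) →L[ℝ] ℝ) {a : ℝ}
    {x₀ : Fin d → ℝ} (hx₀ : x₀ ∈ M) (h₀ : ∀ᶠ y in 𝓝[M] x₀, L y = a) :
    ∀ x ∈ M, L x = a := by
  let A : Set M := {x : M | ∀ᶠ y : M in 𝓝 x, L (y : Fin d → ℝ) = a}
  have hA : ∀ x : M, x ∈ A ↔ ∀ᶠ y in 𝓝[M] (x : Fin d → ℝ), L y = a := fun x =>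
    (eventually_nhds_subtype_iff M x fun y => L y = a)
  have hopen : IsOpen A := isOpen_setOfPred_eventually_nhds
  have hclosed : IsClosed A := by
    refine isClosed_of_closure_subset fun x hx => ?_
    obtain ⟨U, Φ, hΦ, v, hv, hvx⟩ := hM x x.2
    obtain ⟨r, hr, hrU⟩ := Metric.isOpen_iff.mp hΦ.open_dom v hv
    have himg : Φ '' ball v r ∈ 𝓝[M] (x : Fin d → ℝ) :=
      hvx ▸ hΦ.image_mem_nhdsWithin hv (ball_mem_nhds v hr)
    have himg' : ∀ᶠ y : M in 𝓝 x, (y : Fin d → ℝ) ∈ Φ '' ball v r :=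
      (eventually_nhds_subtype_iff M x fun y => y ∈ Φ '' ball v r).mpr himg
    obtain ⟨z, ⟨u, hu, huz⟩, hzA⟩ := mem_closure_iff_nhds.mp hx _ himg'
    rw [hA, ← huz] at hzA
    have hL : AnalyticOnNhd ℝ (fun t => L (Φ t)) (ball v r) := fun t ht =>
      (L.analyticAt _).comp (hΦ.analytic t (hrU ht))
    have heq := hL.eqOn_of_preconnected_of_eventuallyEq (g := fun _ => a) analyticOnNhd_const
      (convex_ball v r).isPreconnected hu (hΦ.eventually_nhds_of_nhdsWithin (hrU hu) hzA)
    rw [hA]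
    filter_upwards [himg] with y ⟨t, ht, hty⟩
    exact hty ▸ heq ht
  have : PreconnectedSpace M := isPreconnected_iff_preconnectedSpace.mp hconn.isPreconnected
  have huniv : A = univ := IsClopen.eq_univ ⟨hclosed, hopen⟩ ⟨⟨x₀, hx₀⟩, (hA _).mpr h₀⟩
  intro x hx
  have : (⟨x, hx⟩ : M) ∈ A := huniv ▸ mem_univ _
  exact Eventually.self_of_nhds (p := fun y : M => L y = a) this

/-- **Observation (ii).** A connected real-analytic submanifold of `ℝ^d` which is
not contained in any affine hyperplane is nondegenerate at every point. -/
theorem analytic_not_hyperplanar_nondegenerate (k d : ℕ)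
    (M : Set (Fin d → ℝ)) (hM : IsAnalSubmanifold k d M) (hconn : IsConnected M)
    (hpl : ¬ ∃ (w : Fin d → ℝ) (a : ℝ), w ≠ 0 ∧ ∀ x ∈ M, (∑ i, w i * x i) = a) :
    ∀ x ∈ M, IsAnalNondeg k d M x := by
  intro x hx
  by_contra hdeg
  obtain ⟨U, Φ, hΦ, v, hv, rfl⟩ := hM x hx
  obtain ⟨L, hL, hker⟩ := exists_linear_functional_of_not_isAnalNondeg hΦ hv hdeg
  have hloc := eventually_eq_of_mderiv_eq_zero hΦ.open_dom hΦ.analytic hv L hker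
  have hnear : ∀ᶠ y in 𝓝[M] (Φ v), L y = L (Φ v) := by
    filter_upwards [hΦ.image_mem_nhdsWithin hv hloc] with y ⟨u, hu, huy⟩
    exact huy ▸ hu
  have hsum : ∀ y, ∑ i, L (Pi.single i 1) * y i = L y := fun y => by
    conv_rhs => rw [pi_eq_sum_univ' y]
    simp [mul_comm]
  refine hpl ⟨fun i => L (Pi.single i 1), L (Φ v), fun hw => hL ?_, fun y hy => ?_⟩
  · ext1 y
    simp [← hsum y, fun i => congrFun hw i]
  · rw [hsum]
    exact hM.eq_of_eventually_eq hconn L hx hnear y hy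
end
end

section
/- Fix integers k, n ≥ 1 and let d = C(k+n, n) − 1. Then every point of the Veronese variety V_{k,n} = Ψ_{k,n}(ℝ^k) ⊆ ℝ^d is n-nondegenerate: for every t ∈ ℝ^k, the partial derivatives ∂^α Ψ_{k,n}(t), over all multi-indices α ∈ ℕ^k with 0 < |α| ≤ n, span ℝ^d. -/
open Set Filter Metric MeasureTheory
noncomputable section

/-- The map `t ↦ (c i * t ^ b i)_i` whose coordinates are scaled monomials. -/
def monomialMap {ι : Type*} {k : ℕ} (c : ι → ℝ) (b : ι → Fin k → ℕ) :
    (Fin k → ℝ) → ι → ℝ :=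
  fun t i => c i * ∏ j, t j ^ b i j

lemma dirD_monomialMap {ι : Type*} [Fintype ι] {k : ℕ} (c : ι → ℝ) (b : ι → Fin k → ℕ)
    (j : Fin k) :
    dirD (Pi.single j 1) (monomialMap c b) =
      monomialMap (fun i => c i * b i j) (fun i => b i - Pi.single j 1) := by
  funext t
  have h (i : ι) : HasFDerivAt (fun x : Fin k → ℝ => c i * ∏ l, x l ^ b i l)
      (c i • ∑ l, (∏ m ∈ Finset.univ.erase l, t m ^ b i m) •
        ((b i l * t l ^ (b i l - 1)) • ContinuousLinearMap.proj (R := ℝ)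
          (φ := fun _ : Fin k => ℝ) l)) t := by
    refine (HasFDerivAt.finsetProd fun l _ => ?_).const_mul _
    simpa using (hasFDerivAt_apply (𝕜 := ℝ) l t).pow (b i l)
  have hderiv : HasFDerivAt (monomialMap c b) _ t := hasFDerivAt_pi.2 h
  funext i
  rw [dirD, hderiv.fderiv]
  have hprod : ∏ l, t l ^ (b i - Pi.single j 1 : Fin k → ℕ) l =
      t j ^ (b i j - 1) * ∏ m ∈ Finset.univ.erase j, t m ^ b i m := by
    rw [← Finset.mul_prod_erase Finset.univ _ (Finset.mem_univ j)]
    congr 1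
    · simp
    · refine Finset.prod_congr rfl fun m hm => ?_
      simp [Pi.single_eq_of_ne (Finset.ne_of_mem_erase hm)]
  simp only [monomialMap, hprod, ContinuousLinearMap.pi_apply, smul_apply,
    sum_apply, ContinuousLinearMap.proj_apply, smul_eq_mul]
  rw [Finset.sum_eq_single j (fun l _ hl => by simp [Pi.single_eq_of_ne hl]) (by simp)]
  simp only [Pi.single_eq_same]
  ring

lemma iterate_dirD_monomialMap {ι : Type*} [Fintype ι] {k : ℕ} (c : ι → ℝ)
    (b : ι → Fin k → ℕ) (j : Fin k) (m : ℕ) :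
    (dirD (Pi.single j 1))^[m] (monomialMap c b) =
      monomialMap (fun i => c i * (b i j).descFactorial m) (fun i => b i - Pi.single j m) := by
  induction m with
  | zero => simp
  | succ m ih =>
    rw [Function.iterate_succ_apply', ih, dirD_monomialMap]
    congr 1
    · funext i
      simp only [Pi.sub_apply, Pi.single_eq_same, Nat.descFactorial_succ]
      push_cast
      ring
    · funext i
      rw [tsub_tsub, ← Pi.single_add]

lemma foldr_dirD_monomialMap {ι : Type*} [Fintype ι] {k : ℕ} (c : ι → ℝ)
    (b : ι → Fin k → ℕ) (α : Fin k → ℕ) (l : List (Fin k)) (hl : l.Nodup) :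
    l.foldr (fun j g => (dirD (Pi.single j 1))^[α j] g) (monomialMap c b) =
      monomialMap (fun i => c i * (l.map fun j => ((b i j).descFactorial (α j) : ℝ)).prod)
        (fun i j => b i j - if j ∈ l then α j else 0) := by
  induction l with
  | nil => simp
  | cons a l ih =>
    obtain ⟨ha, hl⟩ := List.nodup_cons.1 hl
    rw [List.foldr_cons, ih hl, iterate_dirD_monomialMap]
    congr 1
    · funext i
      simp only [ha, if_false, List.map_cons, List.prod_cons, tsub_zero]
      ring
    · funext i j
      rcases eq_or_ne j a with rfl | hj
      · simp [ha]
      · simp [hj]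

/-- The partial derivatives of a map with monomial coordinates. -/
lemma mderiv_monomials {ι : Type*} [Fintype ι] {k : ℕ} (b : ι → Fin k → ℕ) (α : Fin k → ℕ)
    (t : Fin k → ℝ) (i : ι) :
    mderiv α (fun t i => ∏ j, t j ^ b i j) t i =
      ∏ j, ((b i j).descFactorial (α j) * t j ^ (b i j - α j) : ℝ) := by
  have h := foldr_dirD_monomialMap (fun _ => 1) b α _ (Finset.nodup_toList Finset.univ)
  simp only [one_mul, Finset.mem_toList, Finset.mem_univ, if_true, Finset.prod_map_toList] at h
  have hmap : (fun t i => ∏ j, t j ^ b i j) = monomialMap (fun _ => 1) b := by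
    funext t i
    simp only [monomialMap, one_mul]
  rw [mderiv, multiD, hmap, h, monomialMap, Finset.prod_mul_distrib]

/-- Vectors indexed by multi-indices that are triangular for the componentwise order, with
nonzero diagonal, span the whole space. -/
lemma span_eq_top_of_triangular {ι κ : Type*} [Fintype ι] [Fintype κ] (b : ι → κ → ℕ)
    (hb : Function.Injective b) (f : ι → ι → ℝ) (hdiag : ∀ i, f i i ≠ 0)
    (htri : ∀ i i', f i i' ≠ 0 → b i ≤ b i') :
    Submodule.span ℝ (Set.range f) = ⊤ := by
  classical
  have hsingle (i : ι) : Pi.single i (1 : ℝ) ∈ Submodule.span ℝ (Set.range f) := by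
    have wf : WellFounded fun i i' : ι => b i' < b i :=
      have : IsTrans ι fun i i' => b i' < b i := ⟨fun _ _ _ h h' => h'.trans h⟩
      have : Std.Irrefl fun i i' : ι => b i' < b i := ⟨fun _ => lt_irrefl _⟩
      Finite.wellFounded_of_trans_of_irrefl _
    induction i using wf.induction with
    | _ i ih =>
      have hsum : f i = f i i • Pi.single i (1 : ℝ) +
          ∑ i' ∈ Finset.univ.erase i, f i i' • Pi.single i' (1 : ℝ) := by
        rw [Finset.add_sum_erase Finset.univ (fun i' => f i i' • Pi.single i' (1 : ℝ))
          (Finset.mem_univ i)]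
        exact pi_eq_sum_univ' (f i)
      have hrest : ∑ i' ∈ Finset.univ.erase i, f i i' • Pi.single i' (1 : ℝ) ∈
          Submodule.span ℝ (Set.range f) := by
        refine Submodule.sum_mem _ fun i' hi' => ?_
        by_cases h0 : f i i' = 0
        · simp [h0]
        · exact Submodule.smul_mem _ _ (ih i' ((htri i i' h0).lt_of_ne
            fun h => Finset.ne_of_mem_erase hi' (hb h).symm))
      have hmem : f i i • Pi.single i (1 : ℝ) ∈ Submodule.span ℝ (Set.range f) := by
        rw [← Submodule.add_mem_iff_left _ hrest, ← hsum]
        exact Submodule.subset_span ⟨i, rfl⟩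
      exact (Submodule.smul_mem_iff _ (hdiag i)).1 hmem
  refine Submodule.eq_top_iff'.2 fun x => ?_
  rw [pi_eq_sum_univ' x]
  exact Submodule.sum_mem _ fun i _ => Submodule.smul_mem _ _ (hsingle i)

/-- **The Veronese variety is `n`-nondegenerate at every point:** for every
`t ∈ ℝ^k`, the partial derivatives `∂^α Ψ_{k,n}(t)` over all multi-indices `α` with
`0 < |α| ≤ n` span `ℝ^d`, where `d = C(k+n,n) − 1` and the coordinates of
`Ψ_{k,n}(t)` are the monomials `t^α`, `0 < |α| ≤ n` (enumerated by `e`). -/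
theorem veronese_nondegenerate (k n : ℕ) (hk : 1 ≤ k) (hn : 1 ≤ n) (d : ℕ)
    (hd : d + 1 = Nat.choose (k + n) n)
    (e : Fin d ≃ {α : Fin k → ℕ // 0 < (∑ j, α j) ∧ (∑ j, α j) ≤ n})
    (Ψ : (Fin k → ℝ) → (Fin d → ℝ))
    (hΨ : Ψ = fun t i => ∏ j, t j ^ ((e i).1 j))
    (t : Fin k → ℝ) :
    Submodule.span ℝ {y : Fin d → ℝ | ∃ α : Fin k → ℕ,
      0 < (∑ j, α j) ∧ (∑ j, α j) ≤ n ∧ y = mderiv α Ψ t} = ⊤ := by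
  subst hΨ
  refine top_unique ?_
  rw [← span_eq_top_of_triangular (fun i => (e i).1) (Subtype.val_injective.comp e.injective)
    (fun i => mderiv (e i).1 (fun t i => ∏ j, t j ^ ((e i).1 j)) t)]
  · refine Submodule.span_mono ?_
    rintro _ ⟨i, rfl⟩
    exact ⟨(e i).1, (e i).2.1, (e i).2.2, rfl⟩
  · intro i
    rw [mderiv_monomials, Finset.prod_ne_zero_iff]
    intro j _
    simp [Nat.descFactorial_self, Nat.factorial_ne_zero]
  · intro i i' h j
    rw [mderiv_monomials, Finset.prod_ne_zero_iff] at h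
    by_contra! hlt
    exact h j (Finset.mem_univ j) (by simp [Nat.descFactorial_eq_zero_iff_lt.2 hlt])
end
end

section
/- Fix integers k, n ≥ 1 and let d = C(k+n, n) − 1. Then the Veronese variety V_{k,n} ⊆ ℝ^d is maximally approximable; that is, ψ_{c(k,d)} is a Dirichlet function for intrinsic approximation on V_{k,n}: for every x ∈ V_{k,n} there exist C_x > 0 and a sequence of rational points r_m ∈ ℚ^d ∩ V_{k,n} with r_m → x and ‖x − r_m‖_∞ ≤ C_x·H(r_m)^{−c(k,d)} for all m, where c(k,d) = (k+1)/(k·n). -/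
open Set Filter Metric MeasureTheory
noncomputable section

/-- Dirichlet's theorem on simultaneous approximation. -/
theorem exists_simultaneous_approx {k : ℕ} (t : Fin k → ℝ) {Q : ℕ} (hQ : 0 < Q) :
    ∃ q : ℕ, 0 < q ∧ q ≤ Q ^ k ∧ ∃ p : Fin k → ℤ, ∀ j, |q * t j - p j| ≤ 1 / (Q : ℝ) := by
  have hQ' : (0 : ℝ) < Q := by exact_mod_cast hQ
  have hlt (q : ℕ) (j : Fin k) : ⌊(Q : ℝ) * Int.fract (q * t j)⌋₊ < Q := by
    rw [Nat.floor_lt (by positivity)]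
    have := Int.fract_lt_one ((q : ℝ) * t j)
    nlinarith
  let box : Fin (Q ^ k + 1) → (Fin k → Fin Q) := fun q j ↦ ⟨_, hlt q j⟩
  obtain ⟨a, b, hab, hbox⟩ : ∃ a b, a < b ∧ box a = box b := by
    obtain ⟨a, b, hne, hbox⟩ := Fintype.exists_ne_map_eq_of_card_lt box (by simp)
    rcases lt_or_gt_of_ne hne with h | h
    exacts [⟨a, b, h, hbox⟩, ⟨b, a, h, hbox.symm⟩]
  have hab' : (a : ℕ) < b := hab
  refine ⟨b - a, by omega, by omega, fun j ↦ ⌊(b : ℝ) * t j⌋ - ⌊(a : ℝ) * t j⌋, fun j ↦ ?_⟩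
  have hfl : ⌊(Q : ℝ) * Int.fract (a * t j)⌋₊ = ⌊(Q : ℝ) * Int.fract (b * t j)⌋₊ :=
    congrArg Fin.val (congrFun hbox j)
  have ha := Nat.floor_le (a := (Q : ℝ) * Int.fract (a * t j)) (by positivity)
  have ha' := Nat.lt_floor_add_one ((Q : ℝ) * Int.fract (a * t j))
  have hb := Nat.floor_le (a := (Q : ℝ) * Int.fract (b * t j)) (by positivity)
  have hb' := Nat.lt_floor_add_one ((Q : ℝ) * Int.fract (b * t j))
  rw [hfl] at ha ha'
  rw [Nat.cast_sub hab'.le, abs_le, ← neg_div, div_le_iff₀ hQ', le_div_iff₀ hQ']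
  simp only [Int.fract] at *
  push_cast
  constructor <;> nlinarith

theorem ht_pos_le {d : ℕ} {x : Fin d → ℝ} {q : ℕ} (hq : 0 < q)
    (h : ∀ i, ∃ m : ℤ, (q : ℝ) * x i = m) : 0 < ht x ∧ ht x ≤ q :=
  have hmem : q ∈ {q : ℕ | 0 < q ∧ ∀ i, ∃ m : ℤ, (q : ℝ) * x i = m} := ⟨hq, h⟩
  ⟨(Nat.sInf_mem ⟨q, hmem⟩).1, Nat.sInf_le hmem⟩

theorem exists_int_pow_mul_prod_div_pow {k n q : ℕ} (hq : 0 < q) (p : Fin k → ℤ) {α : Fin k → ℕ}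
    (hα : ∑ j, α j ≤ n) :
    ∃ m : ℤ, ((q ^ n : ℕ) : ℝ) * ∏ j, ((p j : ℝ) / q) ^ α j = m := by
  have hq' : (q : ℝ) ≠ 0 := by exact_mod_cast hq.ne'
  refine ⟨q ^ (n - ∑ j, α j) * ∏ j, p j ^ α j, ?_⟩
  push_cast
  simp only [div_pow, Finset.prod_div_distrib, Finset.prod_pow_eq_pow_sum]
  conv_lhs => rw [← Nat.sub_add_cancel hα, pow_add]
  field_simp

/-- The error in Dirichlet's theorem, in terms of a height bounded by `q ^ n`. -/
theorem one_div_mul_le_rpow_height {k n q Q h : ℕ} (hk : 1 ≤ k) (hn : 1 ≤ n) (hq : 0 < q)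
    (hqQ : q ≤ Q ^ k) (hh : 0 < h) (hhq : h ≤ q ^ n) :
    1 / ((q : ℝ) * Q) ≤ (h : ℝ) ^ (-(((k : ℝ) + 1) / ((k : ℝ) * n))) := by
  have hk' : (0 : ℝ) < k := by exact_mod_cast hk
  have hn' : (0 : ℝ) < n := by exact_mod_cast hn
  have hq' : (0 : ℝ) < q := by exact_mod_cast hq
  have hh' : (0 : ℝ) < h := by exact_mod_cast hh
  rw [Real.rpow_neg hh'.le, one_div]
  refine inv_anti₀ (by positivity) ?_
  calc (h : ℝ) ^ (((k : ℝ) + 1) / (k * n))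
      ≤ ((q : ℝ) ^ (n : ℝ)) ^ (((k : ℝ) + 1) / (k * n)) := by
        rw [Real.rpow_natCast]
        exact Real.rpow_le_rpow hh'.le (by exact_mod_cast hhq) (by positivity)
    _ = q * (q : ℝ) ^ (1 / (k : ℝ)) := by
        rw [← Real.rpow_mul hq'.le, ← Real.rpow_one_add' hq'.le (by positivity)]
        congr 1
        field_simp
    _ ≤ q * ((Q : ℝ) ^ k) ^ (1 / (k : ℝ)) := by
        gcongr
        exact_mod_cast hqQ
    _ = q * Q := by
        rw [one_div, Real.pow_rpow_inv_natCast (by positivity) (by omega)]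

/-- **Corollary (the Veronese variety is maximally approximable):** `ψ_{c(k,d)}`,
with `c(k,d) = (k+1)/(k·n)`, is a Dirichlet function for intrinsic approximation
on `V_{k,n} ⊆ ℝ^d`, `d = C(k+n,n) − 1`. -/
theorem veronese_maximally_approximable (k n : ℕ) (hk : 1 ≤ k) (hn : 1 ≤ n) (d : ℕ)
    (hd : d + 1 = Nat.choose (k + n) n)
    (e : Fin d ≃ {α : Fin k → ℕ // 0 < (∑ j, α j) ∧ (∑ j, α j) ≤ n})
    (Ψ : (Fin k → ℝ) → (Fin d → ℝ))
    (hΨ : Ψ = fun t i => ∏ j, t j ^ ((e i).1 j)) :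
    ∀ x ∈ Set.range Ψ, ∃ C > (0 : ℝ), ∃ r : ℕ → (Fin d → ℝ),
      (∀ m, IsRatPt (r m) ∧ r m ∈ Set.range Ψ) ∧
      Filter.Tendsto r Filter.atTop (nhds x) ∧
      ∀ m, ‖x - r m‖ ≤ C * (ht (r m) : ℝ) ^ (-(((k : ℝ) + 1) / ((k : ℝ) * n))) := by
  subst hΨ
  set Ψ : (Fin k → ℝ) → (Fin d → ℝ) := fun t i ↦ ∏ j, t j ^ ((e i).1 j) with hΨ
  rintro _ ⟨t, rfl⟩
  have hcd : ContDiff ℝ 1 Ψ :=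
    contDiff_pi.2 fun i ↦ contDiff_prod fun j _ ↦ (contDiff_apply ℝ ℝ j).pow _
  obtain ⟨K, s, hs, hK⟩ := hcd.contDiffAt.exists_lipschitzOnWith (x := t)
  have happrox (m : ℕ) : ∃ u : Fin k → ℝ, ‖t - u‖ ≤ 1 / ((m : ℝ) + 1) ∧ IsRatPt (Ψ u) ∧
      ‖t - u‖ ≤ (ht (Ψ u) : ℝ) ^ (-(((k : ℝ) + 1) / ((k : ℝ) * n))) := by
    obtain ⟨q, hq, hqQ, p, hp⟩ := exists_simultaneous_approx t m.succ_pos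
    have hq' : (0 : ℝ) < q := by exact_mod_cast hq
    have herr : ‖t - fun j ↦ (p j : ℝ) / q‖ ≤ 1 / ((q : ℝ) * m.succ) := by
      refine (pi_norm_le_iff_of_nonneg (by positivity)).2 fun j ↦ ?_
      have heq : t j - p j / q = (q * t j - p j) / q := by field_simp
      rw [Pi.sub_apply, heq, Real.norm_eq_abs, abs_div, abs_of_pos hq', div_le_iff₀ hq']
      refine (hp j).trans_eq ?_
      field_simp
    obtain ⟨hpos, hle⟩ := ht_pos_le (x := Ψ fun j ↦ (p j : ℝ) / q) (Nat.pow_pos (n := n) hq)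
      fun i ↦ exists_int_pow_mul_prod_div_pow hq p (e i).2.2
    refine ⟨_, herr.trans ?_, fun i ↦ ⟨∏ j, ((p j : ℚ) / q) ^ (e i).1 j, by simp [hΨ]⟩,
      herr.trans (one_div_mul_le_rpow_height hk hn hq hqQ hpos hle)⟩
    rw [Nat.cast_succ]
    have hq1 : (1 : ℝ) ≤ q := by exact_mod_cast hq
    exact one_div_le_one_div_of_le (by positivity) (le_mul_of_one_le_left (by positivity) hq1)
  choose u hu hrat hht using happrox
  have hlim : Tendsto u atTop (nhds t) := by
    rw [tendsto_iff_norm_sub_tendsto_zero]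
    refine squeeze_zero (fun _ ↦ norm_nonneg _) (fun m ↦ ?_) tendsto_one_div_add_atTop_nhds_zero_nat
    rw [norm_sub_rev]
    exact hu m
  obtain ⟨M, hM⟩ := eventually_atTop.1 (hlim.eventually hs)
  refine ⟨K + 1, by positivity, fun m ↦ Ψ (u (m + M)), fun m ↦ ⟨hrat _, mem_range_self _⟩,
    (hcd.continuous.tendsto t).comp (hlim.comp (tendsto_add_atTop_nat M)), fun m ↦ ?_⟩
  calc ‖Ψ t - Ψ (u (m + M))‖ ≤ K * ‖t - u (m + M)‖ :=
        hK.norm_sub_le (mem_of_mem_nhds hs) (hM _ (by omega))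
    _ ≤ (K + 1) * ‖t - u (m + M)‖ := by gcongr; simp
    _ ≤ _ := by gcongr; exact hht _
end
end

section
/- Fix integers d, n ≥ 1, let d' = C(d+n, n) − 1, and let M ⊆ ℝ^d be any subset. If ψ_c(t) = t^{−c} is a Dirichlet function for intrinsic approximation on M (approximation of points of M by ℚ^d ∩ M), then ψ_{c/n}(t) = t^{−c/n} is a Dirichlet function for intrinsic approximation on Ψ_{d,n}(M) ⊆ ℝ^{d'} (approximation of points of Ψ_{d,n}(M) by ℚ^{d'} ∩ Ψ_{d,n}(M)). -/
open Set Filter Metric MeasureTheory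
noncomputable section

/-- The height of a rational point is positive and is a common denominator of its coordinates. -/
theorem IsRatPt.ht_spec {m : ℕ} {x : Fin m → ℝ} (hx : IsRatPt x) :
    0 < ht x ∧ ∀ i, ∃ k : ℤ, (ht x : ℝ) * x i = k := by
  choose a ha using hx
  refine Nat.sInf_mem (s := {q : ℕ | 0 < q ∧ ∀ i, ∃ k : ℤ, (q : ℝ) * x i = k})
    ⟨∏ i, (a i).den, Finset.prod_pos fun i _ => (a i).pos, fun i => ?_⟩
  obtain ⟨b, hb⟩ := Finset.dvd_prod_of_mem (fun i => (a i).den) (Finset.mem_univ i)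
  refine ⟨b * (a i).num, ?_⟩
  have h : ((a i).den : ℝ) * a i = (a i).num := by exact_mod_cast Rat.den_mul_eq_num (a i)
  rw [hb, ha]
  push_cast
  linear_combination (b : ℝ) * h

theorem isRat_monomial {d : ℕ} {r : Fin d → ℝ} (hr : IsRatPt r) (α : Fin d → ℕ) :
    ∃ a : ℚ, ∏ j, r j ^ α j = (a : ℝ) := by
  choose a ha using hr
  exact ⟨∏ j, a j ^ α j, by push_cast; simp only [ha]⟩

/-- If the coordinates of `y` are monomials of degree at most `n` in those of a rational point `r`,
then `ht y ≤ ht r ^ n`. -/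
theorem ht_le_pow_of_monomials {d m n : ℕ} {r : Fin d → ℝ} {y : Fin m → ℝ} (hr : IsRatPt r)
    (hy : ∀ i, ∃ α : Fin d → ℕ, ∑ j, α j ≤ n ∧ y i = ∏ j, r j ^ α j) :
    0 < ht y ∧ ht y ≤ ht r ^ n := by
  obtain ⟨hpos, hint⟩ := hr.ht_spec
  refine ⟨(IsRatPt.ht_spec fun i => ?_).1, Nat.sInf_le ⟨pow_pos hpos n, fun i => ?_⟩⟩
  · obtain ⟨α, -, hα⟩ := hy i
    exact hα ▸ isRat_monomial hr α
  · obtain ⟨α, hdeg, hα⟩ := hy i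
    choose k hk using hint
    refine ⟨(ht r : ℤ) ^ (n - ∑ j, α j) * ∏ j, k j ^ α j, ?_⟩
    push_cast
    simp only [hα, ← hk, mul_pow, Finset.prod_mul_distrib, Finset.prod_pow_eq_pow_sum]
    rw [← mul_assoc, ← pow_add, Nat.sub_add_cancel hdeg]

/-- **Transfer of Dirichlet functions under the Veronese embedding:** if `ψ_c` is a
Dirichlet function for intrinsic approximation on `M ⊆ ℝ^d`, then `ψ_{c/n}` is a
Dirichlet function for intrinsic approximation on `Ψ_{d,n}(M) ⊆ ℝ^{d'}`. -/
theorem veronese_transfers_dirichlet (d n : ℕ) (hd : 1 ≤ d) (hn : 1 ≤ n) (d' : ℕ)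
    (hd' : d' + 1 = Nat.choose (d + n) n)
    (e : Fin d' ≃ {α : Fin d → ℕ // 0 < (∑ j, α j) ∧ (∑ j, α j) ≤ n})
    (Ψ : (Fin d → ℝ) → (Fin d' → ℝ))
    (hΨ : Ψ = fun t i => ∏ j, t j ^ ((e i).1 j))
    (M : Set (Fin d → ℝ)) (c : ℝ) (hc : 0 < c)
    (hdir : IsDirichletFn M (fun t => t ^ (-c))) :
    IsDirichletFn (Ψ '' M) (fun t => t ^ (-(c / (n : ℝ)))) := by
  obtain ⟨-, hdir⟩ := hdir
  refine ⟨fun t ht => Real.rpow_pos_of_pos ht _, ?_⟩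
  rintro _ ⟨x, hx, rfl⟩
  obtain ⟨C, hC, r, hr, hlim, hbound⟩ := hdir x hx
  have hsmooth : ContDiff ℝ 1 Ψ := by
    subst hΨ
    exact contDiff_pi.2 fun i => contDiff_prod fun j _ => (contDiff_apply ℝ ℝ j).pow _
  obtain ⟨K, s, hs, hK⟩ := hsmooth.contDiffAt.exists_lipschitzOnWith (x := x)
  obtain ⟨N, hN⟩ := eventually_atTop.1 (hlim.eventually hs)
  have hmon : ∀ m i, ∃ α : Fin d → ℕ, ∑ j, α j ≤ n ∧ Ψ (r m) i = ∏ j, r m j ^ α j :=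
    fun m i => ⟨(e i).1, (e i).2.2, by rw [hΨ]⟩
  refine ⟨(K + 1) * C, by positivity, fun m => Ψ (r (m + N)), fun m => ⟨?_, ?_⟩, ?_, fun m => ?_⟩
  · intro i
    obtain ⟨α, -, hα⟩ := hmon (m + N) i
    exact (isRat_monomial (hr (m + N)).1 α).imp fun _ => hα.trans
  · exact mem_image_of_mem Ψ (hr (m + N)).2
  · exact (hsmooth.continuous.tendsto x).comp (hlim.comp (tendsto_add_atTop_nat N))
  · obtain ⟨hpos, hle⟩ := ht_le_pow_of_monomials (hr (m + N)).1 (hmon (m + N))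
    have hdist : ‖Ψ x - Ψ (r (m + N))‖ ≤ K * ‖x - r (m + N)‖ := by
      simpa only [dist_eq_norm] using
        hK.dist_le_mul x (mem_of_mem_nhds hs) (r (m + N)) (hN _ (Nat.le_add_left N m))
    have hn' : (n : ℝ) ≠ 0 := by exact_mod_cast (by omega : n ≠ 0)
    have hheight : (ht (r (m + N)) : ℝ) ^ (-c) ≤ (ht (Ψ (r (m + N))) : ℝ) ^ (-(c / (n : ℝ))) := by
      calc (ht (r (m + N)) : ℝ) ^ (-c)
          = ((ht (r (m + N)) : ℝ) ^ n) ^ (-(c / (n : ℝ))) := by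
            rw [← Real.rpow_natCast, ← Real.rpow_mul (Nat.cast_nonneg _)]
            congr 1
            field_simp
        _ ≤ _ := Real.rpow_le_rpow_of_nonpos (by exact_mod_cast hpos) (by exact_mod_cast hle)
            (neg_nonpos.2 (by positivity))
    calc ‖Ψ x - Ψ (r (m + N))‖ ≤ K * ‖x - r (m + N)‖ := hdist
      _ ≤ (K + 1) * (C * (ht (r (m + N)) : ℝ) ^ (-c)) := by
        gcongr
        · linarith
        · exact hbound (m + N)
      _ ≤ (K + 1) * (C * (ht (Ψ (r (m + N))) : ℝ) ^ (-(c / (n : ℝ)))) := by gcongr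
      _ = _ := (mul_assoc _ _ _).symm
end
end

section
/- Fix integers k, D ≥ 1 and β > 0. Then there exists γ > 0 such that for every polynomial f ∈ P_D there exists a polynomial g ∈ P_D with f^{−1}((−γ, γ)) ∩ B(0,1) ⊆ Z_g^{(β)}, where B(0,1) is the closed unit ball in ℝ^k. -/
open Set Filter Metric MeasureTheory
noncomputable section

/-- The polynomial supported on `s` with prescribed coefficients. -/
def polyOfCoeffs {σ : Type*} (s : Finset (σ →₀ ℕ)) (c : s → ℝ) : MvPolynomial σ ℝ :=
  ∑ m : s, MvPolynomial.monomial (m : σ →₀ ℕ) (c m)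

theorem coeff_polyOfCoeffs {σ : Type*} (s : Finset (σ →₀ ℕ)) (c : s → ℝ) (m : s) :
    (polyOfCoeffs s c).coeff m = c m := by
  classical
  simp [polyOfCoeffs, MvPolynomial.coeff_sum, MvPolynomial.coeff_monomial]

theorem coeff_polyOfCoeffs_of_notMem {σ : Type*} (s : Finset (σ →₀ ℕ)) (c : s → ℝ)
    {m : σ →₀ ℕ} (hm : m ∉ s) : (polyOfCoeffs s c).coeff m = 0 := by
  classical
  simp only [polyOfCoeffs, MvPolynomial.coeff_sum, MvPolynomial.coeff_monomial]
  refine Finset.sum_eq_zero fun i _ => if_neg ?_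
  rintro rfl
  exact hm i.2

theorem polyOfCoeffs_coeff {σ : Type*} (s : Finset (σ →₀ ℕ)) (f : MvPolynomial σ ℝ)
    (hf : f.support ⊆ s) : polyOfCoeffs s (fun m => f.coeff m) = f := by
  ext m
  by_cases hm : m ∈ s
  · exact coeff_polyOfCoeffs s _ ⟨m, hm⟩
  · rw [coeff_polyOfCoeffs_of_notMem s _ hm]
    exact (MvPolynomial.notMem_support_iff.1 fun h => hm (hf h)).symm

theorem continuous_eval_polyOfCoeffs {σ : Type*} (s : Finset (σ →₀ ℕ)) :
    Continuous fun z : (s → ℝ) × (σ → ℝ) => MvPolynomial.eval z.2 (polyOfCoeffs s z.1) := by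
  simp only [polyOfCoeffs, map_sum, MvPolynomial.eval_monomial, Finsupp.prod]
  fun_prop

/-- The multi-indices of degree at most `D`. -/
def degLE (k D : ℕ) : Finset (Fin k →₀ ℕ) := (Finsupp.finite_of_degree_le D).toFinset

theorem mem_degLE {k D : ℕ} {m : Fin k →₀ ℕ} : m ∈ degLE k D ↔ m.degree ≤ D := by
  simp [degLE]

theorem support_subset_degLE_iff {k D : ℕ} {f : MvPolynomial (Fin k) ℝ} :
    f.support ⊆ degLE k D ↔ f.totalDegree ≤ D := by
  simp only [MvPolynomial.totalDegree, Finset.sup_le_iff, Finset.subset_iff, mem_degLE]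
  rfl

theorem isPD_polyOfCoeffs_iff {k D : ℕ} (c : degLE k D → ℝ) :
    IsPD k D (polyOfCoeffs (degLE k D) c) ↔ (∀ m, |c m| ≤ 1) ∧ ∃ m, |c m| = 1 := by
  constructor
  · rintro ⟨-, hle, m, hm⟩
    refine ⟨fun m => coeff_polyOfCoeffs _ c m ▸ hle m, ?_⟩
    have hmem : m ∈ degLE k D := by
      by_contra h
      simp [coeff_polyOfCoeffs_of_notMem _ c h] at hm
    exact ⟨⟨m, hmem⟩, by rwa [← coeff_polyOfCoeffs _ c ⟨m, hmem⟩]⟩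
  · rintro ⟨hle, m, hm⟩
    refine ⟨support_subset_degLE_iff.1 fun n hn => ?_, fun n => ?_, m, ?_⟩
    · by_contra h
      exact MvPolynomial.mem_support_iff.1 hn (coeff_polyOfCoeffs_of_notMem _ c h)
    · by_cases h : n ∈ degLE k D
      · rw [coeff_polyOfCoeffs _ c ⟨n, h⟩]
        exact hle _
      · simp [coeff_polyOfCoeffs_of_notMem _ c h]
    · rwa [coeff_polyOfCoeffs]

theorem isCompact_setOf_isPD_polyOfCoeffs (k D : ℕ) :
    IsCompact {c : degLE k D → ℝ | IsPD k D (polyOfCoeffs (degLE k D) c)} := by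
  refine (isCompact_closedBall (0 : degLE k D → ℝ) 1).of_isClosed_subset ?_ fun c hc => ?_
  · simp only [isPD_polyOfCoeffs_iff, ofPred_and, ofPred_forall, ofPred_exists]
    refine (isClosed_iInter fun m => isClosed_le (by fun_prop) (by fun_prop)).inter
      (isClosed_iUnion_of_finite fun m => isClosed_eq (by fun_prop) (by fun_prop))
  · rw [mem_closedBall_zero_iff, pi_norm_le_iff_of_nonneg zero_le_one]
    exact ((isPD_polyOfCoeffs_iff c).1 hc).1

/-- If `F c` is continuous in all variables then near a parameter `c`, small values of `F c'` on
a compact set occur only near the zero set of `F c`. -/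
theorem exists_eventually_small_subset_cnbhd {P X : Type*} [TopologicalSpace P]
    [PseudoMetricSpace X] {F : P → X → ℝ} (hF : Continuous fun z : P × X => F z.1 z.2)
    {B : Set X} (hB : IsCompact B) {β : ℝ} (hβ : 0 < β) (c : P) :
    ∃ γ > (0 : ℝ), ∀ᶠ c' in nhds c,
      {x ∈ B | |F c' x| < γ} ⊆ cnbhd {x | F c x = 0} β := by
  set A := B \ thickening β {x | F c x = 0}
  have hA : IsCompact A := hB.diff isOpen_thickening
  have hFc : Continuous fun x => |F c x| := by
    have : Continuous fun x => F c x := hF.comp (by fun_prop : Continuous fun x => (c, x))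
    fun_prop
  have hpos : ∀ x ∈ A, 0 < |F c x| := fun x hx =>
    abs_pos.2 fun h => hx.2 (self_subset_thickening hβ _ h)
  obtain ⟨γ, hγ, hlt⟩ : ∃ γ > (0 : ℝ), ∀ x ∈ A, γ < |F c x| := by
    obtain ⟨r, hr, h⟩ := hA.exists_forall_le' hFc.continuousOn hpos
    exact ⟨r / 2, by linarith, fun x hx => by linarith [h x hx]⟩
  refine ⟨γ, hγ, ?_⟩
  have hev : ∀ᶠ c' in nhds c, ∀ x ∈ A, γ < |F c' x| :=
    hA.eventually_forall_of_forall_eventually fun x hx =>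
      (continuous_const.tendsto (c, x)).eventually_lt (hF.abs.tendsto (c, x)) (hlt x hx)
  filter_upwards [hev] with c' hc' x hx
  have hxt : x ∈ thickening β {x | F c x = 0} := by
    by_contra h
    exact lt_asymm hx.2 (hc' x ⟨hx.1, h⟩)
  obtain ⟨z, hz, hd⟩ := mem_thickening_iff.1 hxt
  exact ⟨z, hz, hd.le⟩

/-- **Lemma (small values of polynomials in `P_D` lie near zero sets of polynomials
in `P_D`):** there is `γ > 0` such that for every `f ∈ P_D` there is `g ∈ P_D` with
`f⁻¹((−γ,γ)) ∩ B(0,1) ⊆ Z_g^{(β)}`. -/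
theorem small_values_near_zero_set (k D : ℕ) (hk : 1 ≤ k) (hD : 1 ≤ D)
    (β : ℝ) (hβ : 0 < β) :
    ∃ γ > (0 : ℝ), ∀ f : MvPolynomial (Fin k) ℝ, IsPD k D f →
      ∃ g : MvPolynomial (Fin k) ℝ, IsPD k D g ∧
        {x ∈ closedBall (0 : Fin k → ℝ) 1 | |MvPolynomial.eval x f| < γ} ⊆
          cnbhd {x : Fin k → ℝ | MvPolynomial.eval x g = 0} β := by
  have hcover : ∃ γ > (0 : ℝ), ∀ c ∈ {c : degLE k D → ℝ | IsPD k D (polyOfCoeffs _ c)},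
      ∃ g : MvPolynomial (Fin k) ℝ, IsPD k D g ∧
        {x ∈ closedBall (0 : Fin k → ℝ) 1 |
          |MvPolynomial.eval x (polyOfCoeffs (degLE k D) c)| < γ} ⊆
          cnbhd {x : Fin k → ℝ | MvPolynomial.eval x g = 0} β := by
    refine (isCompact_setOf_isPD_polyOfCoeffs k D).induction_on
      (p := fun S => ∃ γ > (0 : ℝ), ∀ c ∈ S, ∃ g : MvPolynomial (Fin k) ℝ, IsPD k D g ∧
        {x ∈ closedBall (0 : Fin k → ℝ) 1 |
          |MvPolynomial.eval x (polyOfCoeffs (degLE k D) c)| < γ} ⊆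
          cnbhd {x : Fin k → ℝ | MvPolynomial.eval x g = 0} β)
      ⟨1, one_pos, by simp⟩ ?_ ?_ ?_
    · rintro S T hST ⟨γ, hγ, h⟩
      exact ⟨γ, hγ, fun c hc => h c (hST hc)⟩
    · rintro S T ⟨γ, hγ, h⟩ ⟨γ', hγ', h'⟩
      refine ⟨min γ γ', lt_min hγ hγ', ?_⟩
      rintro c (hc | hc)
      · obtain ⟨g, hg, hsub⟩ := h c hc
        exact ⟨g, hg, fun x hx => hsub ⟨hx.1, hx.2.trans_le (min_le_left _ _)⟩⟩
      · obtain ⟨g, hg, hsub⟩ := h' c hc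
        exact ⟨g, hg, fun x hx => hsub ⟨hx.1, hx.2.trans_le (min_le_right _ _)⟩⟩
    · intro c hc
      obtain ⟨γ, hγ, hev⟩ := exists_eventually_small_subset_cnbhd
        (F := fun c x => MvPolynomial.eval x (polyOfCoeffs (degLE k D) c))
        (continuous_eval_polyOfCoeffs (degLE k D))
        (isCompact_closedBall (0 : Fin k → ℝ) 1) hβ c
      exact ⟨_, mem_nhdsWithin_of_mem_nhds hev, γ, hγ, fun c' hc' => ⟨_, hc, hc'⟩⟩
  obtain ⟨γ, hγ, h⟩ := hcover
  refine ⟨γ, hγ, fun f hf => ?_⟩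
  have hfc := polyOfCoeffs_coeff (degLE k D) f (support_subset_degLE_iff.2 hf.1)
  have hc := h (fun m => f.coeff m) (by rwa [mem_ofPred_eq, hfc])
  rwa [hfc] at hc
end
end
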